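/- arXiv:2508.04207 — 6 statements merged into one kernel-verified Lean document; each statement's English description precedes it below -/
import Mathlib

section
/- There exists a constant c > 0 such that for every integer N ≥ 1 the Hausdorff dimension of F_N satisfies dimH(F_N) > 1 − c/N. -/
/-- `FN N` is the set of `ψ ∈ [0,1]` admitting a binary expansion
`ψ = Σ_{k≥1} ε_k 2^{-k}` (digits `ε k ∈ {0,1}`, here indexed from `0`) whose digit
sequence contains no `N+2` consecutive equal digits. -/
def FN (N : ℕ) : Set ℝ :=
  {ψ | ∃ ε : ℕ → ℕ, (∀ k, ε k ≤ 1) ∧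
    ψ = ∑' k : ℕ, (ε k : ℝ) / 2 ^ (k + 1) ∧
    ∀ k : ℕ, ∃ j ≤ N + 1, ε (k + j) ≠ ε k}

open Real in
theorem inv_two_pow_le_ofDigits {x : ℕ → Fin 2} {j : ℕ} (hj : x j = 1) :
    ((2 : ℝ) ^ (j + 1))⁻¹ ≤ ofDigits x := by
  have h := (summable_ofDigitsTerm (digits := x)).le_tsum j fun _ _ ↦ ofDigitsTerm_nonneg
  simpa [ofDigits, ofDigitsTerm, hj] using h

open Real in
/-- Two binary expansions which first differ at position `n`, where the larger one has a digit `1`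
among the `M + 1` places after `n`, are at distance at least `2 ^ (-(n + M + 2))`. -/
theorem inv_two_pow_le_ofDigits_sub_ofDigits {x y : ℕ → Fin 2} {n M j : ℕ}
    (hxy : ∀ i < n, x i = y i) (hx : x n = 1) (hy : y n = 0) (hj : j ≤ M)
    (hxj : x (j + (n + 1)) = 1) :
    ((2 : ℝ) ^ (n + M + 2))⁻¹ ≤ ofDigits x - ofDigits y := by
  have hsum : ∑ i ∈ Finset.range n, ofDigitsTerm x i = ∑ i ∈ Finset.range n, ofDigitsTerm y i :=
    Finset.sum_congr rfl fun i hi ↦ by simp [ofDigitsTerm, hxy i (Finset.mem_range.mp hi)]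
  have hX := inv_two_pow_le_ofDigits (x := fun i ↦ x (i + (n + 1))) hxj
  have hY := ofDigits_le_one fun i ↦ y (i + (n + 1))
  rw [ofDigits_eq_sum_add_ofDigits x (n + 1), ofDigits_eq_sum_add_ofDigits y (n + 1),
    Finset.sum_range_succ, Finset.sum_range_succ, hsum]
  simp only [ofDigitsTerm, hx, hy, Nat.cast_ofNat, Fin.val_one, Fin.val_zero, Nat.cast_one,
    Nat.cast_zero, one_mul, zero_mul]
  have hM : ((2 : ℝ) ^ (M + 1))⁻¹ ≤ ((2 : ℝ) ^ (j + 1))⁻¹ := by gcongr; norm_num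
  have hpos : (0 : ℝ) ≤ ((2 : ℝ) ^ (n + 1))⁻¹ := by positivity
  calc ((2 : ℝ) ^ (n + M + 2))⁻¹ = ((2 : ℝ) ^ (n + 1))⁻¹ * ((2 : ℝ) ^ (M + 1))⁻¹ := by
        rw [← mul_inv, ← pow_add]; ring_nf
    _ ≤ ((2 : ℝ) ^ (n + 1))⁻¹ * (1 + ofDigits (fun i ↦ x (i + (n + 1))) -
          ofDigits fun i ↦ y (i + (n + 1))) := by gcongr; linarith
    _ = _ := by ring

/-- If the inverse of `e` is `r`-Hölder on the image of `s`, then `e` shrinks the Hausdorff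
dimension of `s` at most by the factor `r`. -/
theorem mul_dimH_le_dimH_image {X Y : Type*} [MetricSpace X] [MetricSpace Y] {e : X → Y}
    {s : Set X} {C r : NNReal} (hr : 0 < r)
    (h : ∀ x ∈ s, ∀ y ∈ s, dist x y ≤ C * dist (e x) (e y) ^ (r : ℝ)) :
    r * dimH s ≤ dimH (e '' s) := by
  rcases isEmpty_or_nonempty X with hX | hX
  · simp [Set.eq_empty_of_isEmpty s]
  have hr' : (r : ℝ) ≠ 0 := by exact_mod_cast hr.ne'
  have hinj : Set.InjOn e s := fun x hx y hy hxy ↦ by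
    have := h x hx y hy
    rw [hxy, dist_self, Real.zero_rpow hr', mul_zero] at this
    exact dist_le_zero.mp this
  have hinv : Set.LeftInvOn (Function.invFunOn e s) e s := hinj.leftInvOn_invFunOn
  have hholder : HolderOnWith C r (Function.invFunOn e s) (e '' s) := by
    rintro _ ⟨x, hx, rfl⟩ _ ⟨y, hy, rfl⟩
    rw [hinv hx, hinv hy, edist_dist, edist_dist, ENNReal.ofReal_rpow_of_nonneg dist_nonneg r.coe_nonneg,
      ← ENNReal.ofReal_coe_nnreal, ← ENNReal.ofReal_mul C.coe_nonneg]
    exact ENNReal.ofReal_le_ofReal (h x hx y hy)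
  have := hholder.dimH_image_le hr
  rw [hinv.image_image] at this
  rw [mul_comm]
  exact (ENNReal.le_div_iff_mul_le (by simp [hr.ne']) (by simp)).mp this

/-- Split `d` into blocks of length `N` and append to each block the complement of its last
digit. -/
def padBlocks (N : ℕ) (d : ℕ → Fin 2) (k : ℕ) : Fin 2 :=
  if k % (N + 1) = N then d (k / (N + 1) * N + (N - 1)) + 1
  else d (k / (N + 1) * N + k % (N + 1))

theorem padBlocks_add_div {N : ℕ} (hN : 1 ≤ N) (d : ℕ → Fin 2) (j : ℕ) :
    padBlocks N d (j + j / N) = d j := by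
  have hmod : j % N < N := Nat.mod_lt _ hN
  have hk : j + j / N = j % N + (N + 1) * (j / N) := by
    have := Nat.mod_add_div j N
    linarith
  have h1 : (j + j / N) % (N + 1) = j % N := by
    rw [hk, Nat.add_mul_mod_self_left, Nat.mod_eq_of_lt (by omega)]
  have h2 : (j + j / N) / (N + 1) = j / N := by
    rw [hk, Nat.add_mul_div_left _ _ (by omega), Nat.div_eq_of_lt (by omega), zero_add]
  rw [padBlocks, h1, h2, if_neg hmod.ne, Nat.div_add_mod']

theorem padBlocks_succ_ne {N : ℕ} (hN : 1 ≤ N) (d : ℕ → Fin 2) (q : ℕ) :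
    padBlocks N d (q * (N + 1) + N) ≠ padBlocks N d (q * (N + 1) + (N - 1)) := by
  have h1 : ∀ t ≤ N, (q * (N + 1) + t) % (N + 1) = t := fun t ht ↦ by
    rw [Nat.mul_add_mod_self_right, Nat.mod_eq_of_lt (by omega)]
  have h2 : ∀ t ≤ N, (q * (N + 1) + t) / (N + 1) = q := fun t ht ↦ by
    rw [mul_comm, Nat.mul_add_div (by omega), Nat.div_eq_of_lt (by omega), add_zero]
  rw [padBlocks, padBlocks, h1 N le_rfl, h2 N le_rfl, h1 _ (N.sub_le 1), h2 _ (N.sub_le 1),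
    if_pos rfl, if_neg (by omega)]
  generalize d _ = a
  revert a
  decide

theorem exists_padBlocks_ne {N : ℕ} (hN : 1 ≤ N) (d : ℕ → Fin 2) (k : ℕ) :
    ∃ j ≤ N + 1, padBlocks N d (k + j) ≠ padBlocks N d k := by
  by_contra! hcon
  have hconst : ∀ i, k ≤ i → i ≤ k + (N + 1) → padBlocks N d i = padBlocks N d k := fun i h1 h2 ↦ by
    obtain ⟨j, rfl⟩ := Nat.exists_eq_add_of_le h1
    exact hcon j (by omega)
  obtain ⟨q, h1, h2⟩ : ∃ q, k ≤ q * (N + 1) + (N - 1) ∧ q * (N + 1) + N ≤ k + (N + 1) := by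
    have hk := Nat.div_add_mod' k (N + 1)
    have hlt := Nat.mod_lt k N.add_one_pos
    by_cases h : k % (N + 1) = N
    · refine ⟨k / (N + 1) + 1, ?_, ?_⟩ <;> rw [add_mul] <;> omega
    · exact ⟨k / (N + 1), by omega, by omega⟩
  exact padBlocks_succ_ne hN d q
    ((hconst _ (by omega) h2).trans (hconst _ h1 (by omega)).symm)

theorem exists_padBlocks_eq_one {N : ℕ} (hN : 1 ≤ N) (d : ℕ → Fin 2) (k : ℕ) :
    ∃ j ≤ N + 1, padBlocks N d (j + k) = 1 := by
  by_contra! hcon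
  obtain ⟨j, hj, hne⟩ := exists_padBlocks_ne hN d k
  have h1 := hcon j hj
  have h2 := hcon 0 (Nat.zero_le _)
  rw [zero_add] at h2
  rw [add_comm] at hne
  omega

theorem ofDigits_padBlocks_mem_FN {N : ℕ} (hN : 1 ≤ N) (d : ℕ → Fin 2) :
    Real.ofDigits (padBlocks N d) ∈ FN N := by
  refine ⟨fun k ↦ padBlocks N d k, fun k ↦ Nat.le_of_lt_succ (padBlocks N d k).is_lt, ?_,
    fun k ↦ ?_⟩
  · simp [Real.ofDigits, Real.ofDigitsTerm, div_eq_mul_inv]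
  · obtain ⟨j, hj, hne⟩ := exists_padBlocks_ne hN d k
    exact ⟨j, hj, fun h ↦ hne (Fin.ext h)⟩

/-- If the padded sequences agree before position `n`, the original ones agree in about
`n * N / (N + 1)` places. -/
theorem abs_ofDigits_sub_le_of_padBlocks {N n : ℕ} (hN : 1 ≤ N) {d d' : ℕ → Fin 2}
    (h : ∀ i < n, padBlocks N d i = padBlocks N d' i) :
    |Real.ofDigits d - Real.ofDigits d'| ≤ 2 * ((2 : ℝ) ^ n)⁻¹ ^ ((N : ℝ) / (N + 1)) := by
  have hagree : ∀ j < n * N / (N + 1), d j = d' j := fun j hj ↦ by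
    have h1 : (j + 1) * (N + 1) ≤ n * N := (Nat.le_div_iff_mul_le (by omega)).mp hj
    have h2 : j / N * N ≤ j := Nat.div_mul_le_self j N
    have h3 : j + j / N < n := by
      by_contra! hcon
      nlinarith [Nat.mul_le_mul_right N hcon]
    rw [← padBlocks_add_div hN d j, ← padBlocks_add_div hN d' j, h _ h3]
  refine (Real.abs_ofDigits_sub_ofDigits_le hagree).trans ?_
  have hfloor : (n : ℝ) * N / (N + 1) ≤ (n * N / (N + 1) : ℕ) + 1 := by
    rw [div_le_iff₀ (by positivity)]
    exact_mod_cast (Nat.lt_div_mul_add (a := n * N) (b := N + 1) (by omega)).le.trans_eq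
      (by ring)
  have hpow : ((2 : ℝ) ^ n)⁻¹ ^ ((N : ℝ) / (N + 1)) = 2 ^ (-((n : ℝ) * N / (N + 1))) := by
    rw [← Real.rpow_natCast, ← Real.rpow_neg zero_le_two, ← Real.rpow_mul zero_le_two]
    ring_nf
  rw [hpow, Nat.cast_ofNat, ← Real.rpow_natCast, ← Real.rpow_neg zero_le_two]
  calc (2 : ℝ) ^ (-((n * N / (N + 1) : ℕ) : ℝ)) ≤ 2 ^ (1 + -((n : ℝ) * N / (N + 1))) :=
        Real.rpow_le_rpow_of_exponent_le one_le_two (by linarith)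
    _ = 2 * 2 ^ (-((n : ℝ) * N / (N + 1))) := by
        rw [Real.rpow_add two_pos, Real.rpow_one]

theorem inv_two_pow_le_abs_ofDigits_padBlocks_sub {N n : ℕ} (hN : 1 ≤ N) {d d' : ℕ → Fin 2}
    (h : ∀ i < n, padBlocks N d i = padBlocks N d' i) (hn : padBlocks N d n ≠ padBlocks N d' n) :
    ((2 : ℝ) ^ (n + N + 3))⁻¹ ≤
      |Real.ofDigits (padBlocks N d) - Real.ofDigits (padBlocks N d')| := by
  wlog hd : padBlocks N d n = 1 generalizing d d'
  · rw [abs_sub_comm]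
    exact this (fun i hi ↦ (h i hi).symm) hn.symm (by omega)
  obtain ⟨j, hj, h1⟩ := exists_padBlocks_eq_one hN d (n + 1)
  exact (inv_two_pow_le_ofDigits_sub_ofDigits h hd (by omega) hj h1).trans (le_abs_self _)

theorem abs_ofDigits_sub_le_mul_rpow {N : ℕ} (hN : 1 ≤ N) (d d' : ℕ → Fin 2) :
    |Real.ofDigits d - Real.ofDigits d'| ≤ 2 * ((2 : ℝ) ^ (N + 3)) ^ ((N : ℝ) / (N + 1)) *
      |Real.ofDigits (padBlocks N d) - Real.ofDigits (padBlocks N d')| ^ ((N : ℝ) / (N + 1)) := by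
  by_cases hdd : padBlocks N d = padBlocks N d'
  · have : d = d' := funext fun j ↦ by
      rw [← padBlocks_add_div hN d j, ← padBlocks_add_div hN d' j, hdd]
    rw [this, sub_self, abs_zero]
    positivity
  · have hex : ∃ n, padBlocks N d n ≠ padBlocks N d' n := Function.ne_iff.mp hdd
    have hlt : ∀ i < Nat.find hex, padBlocks N d i = padBlocks N d' i :=
      fun i hi ↦ not_not.mp (Nat.find_min hex hi)
    refine (abs_ofDigits_sub_le_of_padBlocks hN hlt).trans ?_
    have hsep := inv_two_pow_le_abs_ofDigits_padBlocks_sub hN hlt (Nat.find_spec hex)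
    rw [mul_assoc, ← Real.mul_rpow (by positivity) (abs_nonneg _)]
    gcongr
    calc ((2 : ℝ) ^ Nat.find hex)⁻¹ = 2 ^ (N + 3) * (2 ^ (Nat.find hex + N + 3))⁻¹ := by
          rw [add_assoc, pow_add 2 (Nat.find hex), mul_inv]; field_simp
      _ ≤ _ := by gcongr

theorem ofReal_div_add_one_le_dimH_FN {N : ℕ} (hN : 1 ≤ N) :
    ENNReal.ofReal ((N : ℝ) / (N + 1)) ≤ dimH (FN N) := by
  have hr : (0 : ℝ) < N / (N + 1) := by positivity
  have hdim : dimH (Set.Ico (0 : ℝ) 1) = 1 := by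
    rw [Real.dimH_of_nonempty_interior (by simp), Module.finrank_self, Nat.cast_one]
  have h := mul_dimH_le_dimH_image (s := Set.Ico (0 : ℝ) 1)
    (e := fun y ↦ Real.ofDigits (padBlocks N (Real.digits y 2)))
    (C := (2 * ((2 : ℝ) ^ (N + 3)) ^ ((N : ℝ) / (N + 1))).toNNReal)
    (r := ((N : ℝ) / (N + 1)).toNNReal) (by simpa using hr) fun x hx y hy ↦ by
      rw [Real.coe_toNNReal _ (by positivity), Real.coe_toNNReal _ hr.le, Real.dist_eq,
        Real.dist_eq]
      simpa only [Real.ofDigits_digits one_lt_two hx, Real.ofDigits_digits one_lt_two hy] using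
        abs_ofDigits_sub_le_mul_rpow hN (Real.digits x 2) (Real.digits y 2)
  rw [hdim, mul_one] at h
  refine h.trans (dimH_mono ?_)
  rintro _ ⟨y, -, rfl⟩
  exact ofDigits_padBlocks_mem_FN hN _

/-- There exists a constant c > 0 such that for every integer N ≥ 1 the Hausdorff
dimension of F_N satisfies dimH (F_N) > 1 - c/N. -/
theorem stmt_0 :
    ∃ c : ℝ, 0 < c ∧ ∀ N : ℕ, 1 ≤ N →
      ENNReal.ofReal (1 - c / N) < dimH (FN N) := by
  refine ⟨1, one_pos, fun N hN ↦ lt_of_lt_of_le ?_ (ofReal_div_add_one_le_dimH_FN hN)⟩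
  have hN' : (0 : ℝ) < N := by exact_mod_cast hN
  rw [ENNReal.ofReal_lt_ofReal_iff (by positivity), lt_div_iff₀ (by positivity)]
  have : (1 - 1 / (N : ℝ)) * (N + 1) = N - 1 / N := by field_simp; ring
  rw [this]
  exact sub_lt_self _ (by positivity)
end

section
/- There exists a constant c > 0 such that for every integer N ≥ 1 the Hausdorff measure of F_N in dimension 1 − c/N is positive, i.e. Λ_{1−c/N}(F_N) > 0. -/
open MeasureTheory

/-- If two binary digit sequences agree at index `m`, their values differ by at most
`1 - 2⁻⁽ᵐ⁺¹⁾`. -/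
theorem ofDigits_sub_ofDigits_le_of_eq (m : ℕ) : ∀ x y : ℕ → Fin 2, x m = y m →
    Real.ofDigits y - Real.ofDigits x ≤ 1 - ((2 : ℝ) ^ (m + 1))⁻¹ := by
  have step (a : ℕ → Fin 2) :
      Real.ofDigits a = ((a 0 : ℕ) : ℝ) / 2 + Real.ofDigits (fun i ↦ a (i + 1)) / 2 := by
    rw [Real.ofDigits_eq_sum_add_ofDigits a 1]
    simp [Real.ofDigitsTerm]
    ring
  induction m with
  | zero =>
    intro x y h
    rw [step x, step y, h]
    have h₁ := Real.ofDigits_le_one fun i ↦ y (i + 1)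
    have h₂ := Real.ofDigits_nonneg fun i ↦ x (i + 1)
    norm_num
    linarith
  | succ m ih =>
    intro x y h
    rw [step x, step y]
    have h₁ := ih (fun i ↦ x (i + 1)) (fun i ↦ y (i + 1)) h
    have h₂ : ((y 0 : ℕ) : ℝ) ≤ 1 := by exact_mod_cast Nat.lt_succ_iff.1 (y 0).2
    have h₃ : (0 : ℝ) ≤ ((x 0 : ℕ) : ℝ) := Nat.cast_nonneg _
    rw [pow_succ, mul_inv]
    linarith

/-- Two binary digit sequences which first differ at `p` and agree at some later index `q` have
values at distance at least `2⁻⁽ᑫ⁺¹⁾`. -/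
theorem inv_two_pow_le_abs_ofDigits_sub {x y : ℕ → Fin 2} {p q : ℕ} (hpq : p < q)
    (heq : ∀ i < p, x i = y i) (hne : x p ≠ y p) (hq : x q = y q) :
    ((2 : ℝ) ^ (q + 1))⁻¹ ≤ |Real.ofDigits x - Real.ofDigits y| := by
  wlog hlt : y p < x p generalizing x y
  · rw [abs_sub_comm]
    exact this (fun i hi ↦ (heq i hi).symm) hne.symm hq.symm (lt_of_le_of_ne (not_lt.1 hlt) hne)
  refine le_trans ?_ (le_abs_self _)
  obtain ⟨m, rfl⟩ : ∃ m, q = m + (p + 1) := ⟨q - (p + 1), by omega⟩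
  have hx : ((x p : ℕ) : ℝ) = 1 := by norm_cast; omega
  have hy : ((y p : ℕ) : ℝ) = 0 := by norm_cast; omega
  have hsum : ∑ i ∈ Finset.range p, Real.ofDigitsTerm x i =
      ∑ i ∈ Finset.range p, Real.ofDigitsTerm y i :=
    Finset.sum_congr rfl fun i hi ↦ by simp [Real.ofDigitsTerm, heq i (Finset.mem_range.1 hi)]
  have h := ofDigits_sub_ofDigits_le_of_eq m (fun i ↦ x (i + (p + 1))) (fun i ↦ y (i + (p + 1))) hq
  rw [Real.ofDigits_eq_sum_add_ofDigits x (p + 1), Real.ofDigits_eq_sum_add_ofDigits y (p + 1),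
    Finset.sum_range_succ, Finset.sum_range_succ, hsum]
  simp only [Real.ofDigitsTerm, hx, hy, Nat.cast_ofNat]
  have hpos : (0 : ℝ) < (2 ^ (p + 1))⁻¹ := by positivity
  have e : ((2 : ℝ) ^ (m + (p + 1) + 1))⁻¹ = (2 ^ (p + 1))⁻¹ * (2 ^ (m + 1))⁻¹ := by
    rw [← mul_inv, ← pow_add]; congr 2; omega
  rw [e]
  nlinarith

/-- Insert the digits `0, 1` after each block of `N` digits. -/
def insertZeroOne (N : ℕ) (δ : ℕ → Fin 2) (k : ℕ) : Fin 2 :=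
  if k % (N + 2) < N then δ (N * (k / (N + 2)) + k % (N + 2))
  else if k % (N + 2) = N then 0 else 1

theorem insertZeroOne_mul_add {N r : ℕ} (δ : ℕ → Fin 2) (k : ℕ) (hr : r < N + 2) :
    insertZeroOne N δ ((N + 2) * k + r) =
      if r < N then δ (N * k + r) else if r = N then 0 else 1 := by
  have h₁ : ((N + 2) * k + r) % (N + 2) = r := by
    rw [Nat.mul_add_mod, Nat.mod_eq_of_lt hr]
  have h₂ : ((N + 2) * k + r) / (N + 2) = k := by
    rw [Nat.mul_add_div (by omega), Nat.div_eq_of_lt hr, add_zero]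
  simp only [insertZeroOne, h₁, h₂]

theorem exists_insertZeroOne_ne (N : ℕ) (δ : ℕ → Fin 2) (k : ℕ) :
    ∃ j ≤ N + 1, insertZeroOne N δ (k + j) ≠ insertZeroOne N δ k := by
  have hmod : k % (N + 2) < N + 2 := Nat.mod_lt _ (by omega)
  have hk := Nat.div_add_mod k (N + 2)
  generalize k % (N + 2) = r at hmod hk
  generalize k / (N + 2) = d at hk
  have hz (d : ℕ) : insertZeroOne N δ ((N + 2) * d + N) = 0 := by
    simp [insertZeroOne_mul_add δ d (show N < N + 2 by omega)]
  have ho : insertZeroOne N δ ((N + 2) * d + (N + 1)) = 1 := by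
    simp [insertZeroOne_mul_add δ d (show N + 1 < N + 2 by omega)]
  rcases Nat.lt_or_ge N r with hr | hr
  · refine ⟨N + 1, le_rfl, ?_⟩
    have e₁ : k = (N + 2) * d + (N + 1) := by omega
    have e₂ : k + (N + 1) = (N + 2) * (d + 1) + N := by rw [mul_add]; omega
    rw [e₂, hz, e₁, ho]
    decide
  · by_contra! h
    have h₁ := h (N - r) (by omega)
    have h₂ := h (N + 1 - r) (by omega)
    rw [show k + (N - r) = (N + 2) * d + N by omega, hz] at h₁
    rw [show k + (N + 1 - r) = (N + 2) * d + (N + 1) by omega, ho, ← h₁] at h₂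
    exact absurd h₂ (by decide)

theorem ofDigits_insertZeroOne_mem_FN (N : ℕ) (δ : ℕ → Fin 2) :
    Real.ofDigits (insertZeroOne N δ) ∈ FN N := by
  refine ⟨fun k ↦ insertZeroOne N δ k, fun k ↦ Nat.lt_succ_iff.1 (insertZeroOne N δ k).2, ?_, ?_⟩
  · simp only [Real.ofDigits, Real.ofDigitsTerm, div_eq_mul_inv, Nat.cast_ofNat]
  · intro k
    obtain ⟨j, hj, h⟩ := exists_insertZeroOne_ne N δ k
    exact ⟨j, hj, fun e ↦ h (Fin.ext e)⟩

theorem abs_ofDigits_sub_le_insertZeroOne {N : ℕ} (hN : 1 ≤ N) (x y : ℕ → Fin 2) :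
    |Real.ofDigits x - Real.ofDigits y| ≤
      2 ^ N * |Real.ofDigits (insertZeroOne N x) - Real.ofDigits (insertZeroOne N y)| ^
        ((N : ℝ) / (N + 2)) := by
  by_cases hxy : x = y
  · subst hxy
    simp only [sub_self, abs_zero]
    positivity
  classical
  have hex : ∃ n, x n ≠ y n := Function.ne_iff.1 hxy
  obtain ⟨n, hn, hmin⟩ : ∃ n, x n ≠ y n ∧ ∀ i < n, x i = y i :=
    ⟨Nat.find hex, Nat.find_spec hex, fun i hi ↦ not_not.1 (Nat.find_min hex hi)⟩
  have hr : n % N < N := Nat.mod_lt _ hN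
  have hdiv := Nat.div_add_mod n N
  generalize n % N = r at hr hdiv
  generalize n / N = k at hdiv
  have hupper := Real.abs_ofDigits_sub_ofDigits_le hmin
  have hlower : ((2 : ℝ) ^ ((N + 2) * k + N + 1))⁻¹ ≤
      |Real.ofDigits (insertZeroOne N x) - Real.ofDigits (insertZeroOne N y)| := by
    refine inv_two_pow_le_abs_ofDigits_sub (p := (N + 2) * k + r) (by omega) ?_ ?_ ?_
    · intro i hi
      have hs : i % (N + 2) < N + 2 := Nat.mod_lt _ (by omega)
      simp only [insertZeroOne]
      split_ifs with h
      · apply hmin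
        have hi' := Nat.div_add_mod i (N + 2)
        generalize i % (N + 2) = s at *
        generalize i / (N + 2) = l at *
        rcases lt_trichotomy l k with hl | rfl | hl
        · have := Nat.mul_le_mul_left N (Nat.succ_le_of_lt hl)
          rw [Nat.succ_eq_add_one, mul_add] at this
          omega
        · omega
        · have := Nat.mul_le_mul_left (N + 2) (Nat.succ_le_of_lt hl)
          rw [Nat.succ_eq_add_one, mul_add] at this
          omega
      · rfl
      · rfl
    · rw [insertZeroOne_mul_add x k (by omega), insertZeroOne_mul_add y k (by omega), if_pos hr,
        if_pos hr, hdiv]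
      exact hn
    · rw [insertZeroOne_mul_add x k (by omega), insertZeroOne_mul_add y k (by omega)]
      simp
  have hlower' : ((2 : ℝ) ^ ((N + 2) * (k + 1)))⁻¹ ≤
      |Real.ofDigits (insertZeroOne N x) - Real.ofDigits (insertZeroOne N y)| := by
    refine le_trans ?_ hlower
    gcongr
    · norm_num
    · rw [mul_add]; omega
  have hpow : (((2 : ℝ) ^ ((N + 2) * (k + 1)))⁻¹) ^ ((N : ℝ) / (N + 2)) =
      (2 ^ (N * (k + 1)))⁻¹ := by
    rw [Real.inv_rpow (by positivity), ← Real.rpow_natCast, ← Real.rpow_mul (by norm_num),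
      ← Real.rpow_natCast]
    congr 2
    push_cast
    field_simp
  calc |Real.ofDigits x - Real.ofDigits y| ≤ ((2 : ℝ) ^ n)⁻¹ := by exact_mod_cast hupper
    _ ≤ (2 ^ (N * k))⁻¹ := by
        gcongr
        · norm_num
        · omega
    _ = 2 ^ N * (2 ^ (N * (k + 1)))⁻¹ := by
        rw [mul_add, mul_one, pow_add]
        field_simp
    _ ≤ _ := by
        rw [← hpow]
        gcongr

theorem hausdorffMeasure_FN_pos {N : ℕ} (hN : 1 ≤ N) : 0 < μH[(N : ℝ) / (N + 2)] (FN N) := by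
  set X : (ℕ → Fin 2) → ℝ := fun δ ↦ Real.ofDigits (insertZeroOne N δ)
  set g : ℝ → ℝ := fun ψ ↦ Real.ofDigits (Function.invFun X ψ)
  have hr : (0 : ℝ) < N / (N + 2) := by positivity
  have hg (δ : ℕ → Fin 2) : g (X δ) = Real.ofDigits δ := by
    have h := abs_ofDigits_sub_le_insertZeroOne hN (Function.invFun X (X δ)) δ
    have e : X (Function.invFun X (X δ)) = X δ := Function.invFun_eq ⟨δ, rfl⟩
    change _ ≤ 2 ^ N * |X _ - X _| ^ _ at h
    rw [e, sub_self, abs_zero, Real.zero_rpow hr.ne', mul_zero] at h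
    exact sub_eq_zero.1 (abs_nonpos_iff.1 h)
  have hholder : HolderOnWith (2 ^ N) (NNReal.mk _ hr.le) g (Set.range X) := by
    rintro _ ⟨x, rfl⟩ _ ⟨y, rfl⟩
    rw [hg, hg, edist_dist, edist_dist, Real.dist_eq, Real.dist_eq, NNReal.coe_mk,
      ENNReal.ofReal_rpow_of_nonneg (abs_nonneg _) hr.le]
    refine (ENNReal.ofReal_le_ofReal (abs_ofDigits_sub_le_insertZeroOne hN x y)).trans_eq ?_
    rw [ENNReal.ofReal_mul (by positivity), ENNReal.ofReal_pow (by norm_num)]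
    simp [X]
  have himage : Set.Icc (0 : ℝ) 1 ⊆ g '' Set.range X := fun t ht ↦ by
    obtain ⟨δ, -, rfl⟩ := Real.ofDigits_SurjOn one_lt_two ht
    exact ⟨X δ, ⟨δ, rfl⟩, hg δ⟩
  have hle := (measure_mono himage).trans
    (hholder.hausdorffMeasure_image_le (d := 1) (by exact_mod_cast hr) zero_le_one)
  rw [hausdorffMeasure_real, Real.volume_Icc, NNReal.coe_mk, mul_one] at hle
  have hpos : 0 < μH[(N : ℝ) / (N + 2)] (Set.range X) := by
    by_contra! h
    rw [nonpos_iff_eq_zero.1 h, mul_zero] at hle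
    norm_num at hle
  refine hpos.trans_le (measure_mono ?_)
  rintro _ ⟨δ, rfl⟩
  exact ofDigits_insertZeroOne_mem_FN N δ

/-- There exists a constant c > 0 such that for every integer N ≥ 1 the Hausdorff
measure of F_N in dimension 1 - c/N is positive. -/
theorem stmt_1 :
    ∃ c : ℝ, 0 < c ∧ ∀ N : ℕ, 1 ≤ N →
      0 < μH[1 - c / N] (FN N) := by
  refine ⟨2, two_pos, fun N hN ↦ (hausdorffMeasure_FN_pos hN).trans_le
    (Measure.hausdorffMeasure_mono ?_ _)⟩
  have hN' : (0 : ℝ) < N := by exact_mod_cast hN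
  rw [one_sub_div hN'.ne', div_le_div_iff₀ hN' (by positivity)]
  nlinarith
end

section
/- For every integer N ≥ 1 there exists a sequence (𝒦_k)_{k∈ℕ} of finite collections of pairwise disjoint dyadic subintervals of [0,1] such that, writing K_k for the union of the closures of the intervals in 𝒦_k, the following hold: (i) F_N ⊆ K_k for every k; (ii) F_N = ⋂_{k∈ℕ} K_k; (iii) for every J ∈ 𝒦_k the Lebesgue measure of J ∩ K_{k+1} is at least |J|/2; (iv) whenever J ∈ 𝒦_k and I ∈ 𝒦_{k+1} satisfy I ∩ J ≠ ∅, then I ⊆ J and |I| < 2^{−N}|J|. -/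
open scoped ENNReal

/-- A dyadic interval is an interval [j·2^{-m}, (j+1)·2^{-m}) with integers m ≥ 0 and
0 ≤ j < 2^m. -/
def IsDyadicInterval (J : Set ℝ) : Prop :=
  ∃ m j : ℕ, j < 2 ^ m ∧ J = Set.Ico ((j : ℝ) / 2 ^ m) (((j : ℝ) + 1) / 2 ^ m)

open Set MeasureTheory

/-- The dyadic interval `[j / 2 ^ m, (j + 1) / 2 ^ m)`. -/
def dyadicIco (m j : ℕ) : Set ℝ :=
  Ico ((j : ℝ) / 2 ^ m) (((j : ℝ) + 1) / 2 ^ m)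

/-- Among the lowest `m` binary digits of `j` there are no `N + 2` consecutive equal ones. -/
def NoLongRun (N m j : ℕ) : Prop :=
  ∀ i, i + N + 1 < m → ∃ t ≤ N + 1, j.testBit (i + t) ≠ j.testBit i

/-- The dyadic intervals of length `2 ^ (-m)` given by binary words without `N + 2` consecutive
equal digits. -/
def admissibleIntervals (N m : ℕ) : Set (Set ℝ) :=
  {J | ∃ j < 2 ^ m, NoLongRun N m j ∧ J = dyadicIco m j}

lemma mem_dyadicIco {m j : ℕ} {x : ℝ} :
    x ∈ dyadicIco m j ↔ 0 ≤ x ∧ ⌊2 ^ m * x⌋₊ = j := by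
  have h2 : (0 : ℝ) < 2 ^ m := by positivity
  have key : x ∈ dyadicIco m j ↔ (j : ℝ) ≤ 2 ^ m * x ∧ 2 ^ m * x < j + 1 := by
    rw [dyadicIco, mem_Ico, div_le_iff₀' h2, lt_div_iff₀' h2]
  rw [key]
  constructor
  · intro h
    have h0 : 0 ≤ 2 ^ m * x := (Nat.cast_nonneg j).trans h.1
    exact ⟨nonneg_of_mul_nonneg_right h0 h2, (Nat.floor_eq_iff h0).2 h⟩
  · rintro ⟨h0, h⟩
    exact (Nat.floor_eq_iff (by positivity)).1 h

lemma closure_dyadicIco (m j : ℕ) :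
    closure (dyadicIco m j) = Icc ((j : ℝ) / 2 ^ m) (((j : ℝ) + 1) / 2 ^ m) := by
  refine closure_Ico (ne_of_lt ?_)
  gcongr
  linarith

lemma mem_closure_dyadicIco {m j : ℕ} {x : ℝ} :
    x ∈ closure (dyadicIco m j) ↔ (j : ℝ) ≤ 2 ^ m * x ∧ 2 ^ m * x ≤ j + 1 := by
  have h2 : (0 : ℝ) < 2 ^ m := by positivity
  rw [closure_dyadicIco, mem_Icc, div_le_iff₀' h2, le_div_iff₀' h2]

lemma volume_dyadicIco (m j : ℕ) : volume (dyadicIco m j) = (2 : ℝ≥0∞)⁻¹ ^ m := by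
  rw [dyadicIco, Real.volume_Ico, ← sub_div, add_sub_cancel_left, one_div, ← inv_pow,
    ENNReal.ofReal_pow (by norm_num), ENNReal.ofReal_inv_of_pos (by norm_num)]
  simp

lemma floor_two_pow_mul_div (m l : ℕ) (x : ℝ) :
    ⌊2 ^ (m + l) * x⌋₊ / 2 ^ l = ⌊2 ^ m * x⌋₊ := by
  rw [← Nat.floor_div_natCast]
  congr 1
  push_cast
  rw [pow_add]
  field_simp

lemma dyadicIco_subset {m l i j : ℕ} (h : i / 2 ^ l = j) :
    dyadicIco (m + l) i ⊆ dyadicIco m j := by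
  intro x hx
  rw [mem_dyadicIco] at hx ⊢
  exact ⟨hx.1, by rw [← h, ← hx.2, floor_two_pow_mul_div]⟩

lemma mem_iUnion_closure {N m : ℕ} {x : ℝ} :
    x ∈ ⋃ J ∈ admissibleIntervals N m, closure J ↔
      ∃ j < 2 ^ m, NoLongRun N m j ∧ (j : ℝ) ≤ 2 ^ m * x ∧ 2 ^ m * x ≤ j + 1 := by
  simp only [mem_iUnion, exists_prop]
  constructor
  · rintro ⟨J, ⟨j, hj, hr, rfl⟩, hx⟩
    exact ⟨j, hj, hr, mem_closure_dyadicIco.1 hx⟩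
  · rintro ⟨j, hj, hr, hx⟩
    exact ⟨_, ⟨j, hj, hr, rfl⟩, mem_closure_dyadicIco.2 hx⟩

lemma finite_admissibleIntervals (N m : ℕ) : (admissibleIntervals N m).Finite := by
  refine ((finite_Iio (2 ^ m)).image (dyadicIco m)).subset ?_
  rintro J ⟨j, hj, -, rfl⟩
  exact ⟨j, hj, rfl⟩

lemma pairwise_disjoint_admissibleIntervals (N m : ℕ) :
    (admissibleIntervals N m).Pairwise Disjoint := by
  rintro I ⟨i, -, -, rfl⟩ J ⟨j, -, -, rfl⟩ hne
  rw [disjoint_left]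
  intro x hi hj
  apply hne
  rw [← (mem_dyadicIco.1 hi).2, ← (mem_dyadicIco.1 hj).2]

/-- The integer with binary digits `ε 0, …, ε (n - 1)`, most significant first. -/
def leadingDigits (ε : ℕ → ℕ) : ℕ → ℕ
  | 0 => 0
  | n + 1 => 2 * leadingDigits ε n + ε n

lemma leadingDigits_lt {ε : ℕ → ℕ} (hε : ∀ k, ε k ≤ 1) (n : ℕ) : leadingDigits ε n < 2 ^ n := by
  induction n with
  | zero => simp [leadingDigits]
  | succ n ih =>
    have := hε n
    rw [leadingDigits, pow_succ]
    omega

lemma leadingDigits_div {ε : ℕ → ℕ} (hε : ∀ k, ε k ≤ 1) (n i : ℕ) :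
    leadingDigits ε (n + i) / 2 ^ i = leadingDigits ε n := by
  induction i with
  | zero => simp
  | succ i ih =>
    have := hε (n + i)
    rw [← add_assoc, leadingDigits, pow_succ', ← Nat.div_div_eq_div_mul, ← ih]
    congr 1
    omega

lemma testBit_leadingDigits {ε : ℕ → ℕ} (hε : ∀ k, ε k ≤ 1) (n i : ℕ) :
    (leadingDigits ε (n + 1 + i)).testBit i = decide (ε n = 1) := by
  have := hε n
  rw [Nat.testBit_eq_decide_div_mod_eq, leadingDigits_div hε, leadingDigits]
  congr 2
  omega

lemma sum_range_eq_leadingDigits (ε : ℕ → ℕ) (n : ℕ) :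
    2 ^ n * ∑ i ∈ Finset.range n, (ε i : ℝ) / 2 ^ (i + 1) = leadingDigits ε n := by
  induction n with
  | zero => simp [leadingDigits]
  | succ n ih =>
    rw [Finset.sum_range_succ, mul_add, pow_succ', mul_assoc, ih, leadingDigits]
    push_cast
    field_simp

lemma leadingDigits_le_and_le {ε : ℕ → ℕ} (hε : ∀ k, ε k ≤ 1) (n : ℕ) :
    (leadingDigits ε n : ℝ) ≤ 2 ^ n * ∑' k, (ε k : ℝ) / 2 ^ (k + 1) ∧
      2 ^ n * ∑' k, (ε k : ℝ) / 2 ^ (k + 1) ≤ leadingDigits ε n + 1 := by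
  let d : ℕ → Fin 2 := fun k ↦ ⟨ε k, Nat.lt_succ_of_le (hε k)⟩
  have hd : ∀ k, Real.ofDigitsTerm d k = (ε k : ℝ) / 2 ^ (k + 1) := fun k ↦ by
    simp [Real.ofDigitsTerm, d, div_eq_mul_inv]
  have h := Real.ofDigits_eq_sum_add_ofDigits d n
  rw [Real.ofDigits] at h
  simp only [hd] at h
  rw [h, mul_add, sum_range_eq_leadingDigits, Nat.cast_ofNat, mul_inv_cancel_left₀ (by positivity)]
  have h0 := Real.ofDigits_nonneg (fun i ↦ d (i + n))
  have h1 := Real.ofDigits_le_one (fun i ↦ d (i + n))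
  constructor <;> linarith

lemma FN_subset_iUnion_closure (N m : ℕ) :
    FN N ⊆ ⋃ J ∈ admissibleIntervals N m, closure J := by
  rintro x ⟨ε, hε, rfl, hrun⟩
  refine mem_iUnion_closure.2
    ⟨leadingDigits ε m, leadingDigits_lt hε m, ?_, leadingDigits_le_and_le hε m⟩
  intro i hi
  by_contra! hcon
  obtain ⟨s, rfl⟩ : ∃ s, m = s + (N + 1) + 1 + i := ⟨m - (N + 1) - 1 - i, by omega⟩
  have hbit : ∀ j ≤ N + 1, decide (ε (s + j) = 1) = decide (ε (s + (N + 1)) = 1) := by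
    intro j hj
    have h := hcon (N + 1 - j) (by omega)
    rw [testBit_leadingDigits hε, show s + (N + 1) + 1 + i = s + j + 1 + (i + (N + 1 - j)) by omega,
      testBit_leadingDigits hε] at h
    exact h
  obtain ⟨j, hj, hne⟩ := hrun s
  have h := (hbit j hj).trans (hbit 0 (by omega)).symm
  rw [decide_eq_decide, add_zero] at h
  have := hε s
  have := hε (s + j)
  omega

lemma not_noLongRun_of_near_multiple {N m e j : ℕ} (hm : N + 1 < m)
    (h : j = 2 ^ (N + 2) * e ∨ j + 1 = 2 ^ (N + 2) * e) : ¬ NoLongRun N m j := by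
  intro hr
  obtain ⟨t, ht, hne⟩ := hr 0 (by omega)
  apply hne
  rcases h with rfl | h
  · rw [Nat.testBit_two_pow_mul, Nat.testBit_two_pow_mul]
    simp
    omega
  · obtain ⟨e, rfl⟩ : ∃ e', e = e' + 1 := Nat.exists_eq_succ_of_ne_zero (by rintro rfl; omega)
    have hpos : 0 < 2 ^ (N + 2) := by positivity
    obtain rfl : j = 2 ^ (N + 2) * e + (2 ^ (N + 2) - 1) := by
      rw [mul_add] at h; omega
    have hbit : ∀ s ≤ N + 1,
        (2 ^ (N + 2) * e + (2 ^ (N + 2) - 1)).testBit s = true := by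
      intro s hs
      rw [Nat.testBit_two_pow_mul_add _ (by omega), if_pos (by omega), Nat.testBit_two_pow_sub_one]
      simpa using by omega
    rw [hbit _ (by omega), hbit _ (by omega)]

lemma ne_dyadic_of_mem {N n c m : ℕ} {x : ℝ} (hm : n + (N + 2) ≤ m)
    (hx : x ∈ ⋃ J ∈ admissibleIntervals N m, closure J) : x ≠ c / 2 ^ n := by
  rintro rfl
  obtain ⟨j, -, hr, h1, h2⟩ := mem_iUnion_closure.1 hx
  obtain ⟨s, rfl⟩ := Nat.exists_eq_add_of_le hm
  have hc : (2 : ℝ) ^ (n + (N + 2) + s) * (c / 2 ^ n) = (2 ^ (N + 2) * (2 ^ s * c) : ℕ) := by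
    push_cast
    rw [pow_add, pow_add]
    field_simp
  rw [hc] at h1 h2
  norm_cast at h1 h2
  refine not_noLongRun_of_near_multiple (e := 2 ^ s * c) (by omega) ?_ hr
  omega

lemma iInter_iUnion_closure_subset_FN (N : ℕ) {m : ℕ → ℕ} (hm : ∀ k, k ≤ m k) :
    ⋂ k, ⋃ J ∈ admissibleIntervals N (m k), closure J ⊆ FN N := by
  intro x hx
  rw [mem_iInter] at hx
  have hdy (c n : ℕ) : x ≠ c / 2 ^ n := ne_dyadic_of_mem (hm _) (hx (n + (N + 2)))
  have hfloor (k : ℕ) : ⌊2 ^ m k * x⌋₊ < 2 ^ m k ∧ NoLongRun N (m k) ⌊2 ^ m k * x⌋₊ ∧ 0 ≤ x := by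
    obtain ⟨j, hj, hr, h1, h2⟩ := mem_iUnion_closure.1 (hx k)
    have h0 : 0 ≤ 2 ^ m k * x := (Nat.cast_nonneg j).trans h1
    have hne : 2 ^ m k * x ≠ j + 1 := by
      intro h
      apply hdy (j + 1) (m k)
      push_cast
      rw [← h]
      field_simp
    have hj' : ⌊2 ^ m k * x⌋₊ = j := (Nat.floor_eq_iff h0).2 ⟨h1, lt_of_le_of_ne h2 hne⟩
    rw [hj']
    exact ⟨hj, hr, nonneg_of_mul_nonneg_right h0 (by positivity)⟩
  have hx0 : 0 ≤ x := (hfloor 0).2.2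
  have hx1 : x < 1 := by
    have h := (hfloor 0).1
    rw [Nat.floor_lt (by positivity)] at h
    push_cast at h
    exact (mul_lt_iff_lt_one_right (by positivity)).1 h
  have hdig (k : ℕ) : (Real.digits x 2 k : ℕ) = ⌊2 ^ (k + 1) * x⌋₊ % 2 := by
    simp [Real.digits, mul_comm]
  refine ⟨fun k ↦ Real.digits x 2 k, fun k ↦ Fin.is_le _, ?_, ?_⟩
  · conv_lhs => rw [← Real.ofDigits_digits (b := 2) one_lt_two ⟨hx0, hx1⟩]
    simp [Real.ofDigits, Real.ofDigitsTerm, div_eq_mul_inv]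
  · intro k
    by_contra! hcon
    have hM := hm (k + N + 2)
    have hbit : ∀ s < m (k + N + 2), (⌊2 ^ m (k + N + 2) * x⌋₊).testBit (m (k + N + 2) - 1 - s) =
        decide ((Real.digits x 2 s : ℕ) = 1) := by
      intro s hs
      have hs' : m (k + N + 2) = s + 1 + (m (k + N + 2) - 1 - s) := by omega
      rw [Nat.testBit_eq_decide_div_mod_eq, hdig, ← floor_two_pow_mul_div (s + 1), ← hs']
    obtain ⟨t, ht, hne⟩ := (hfloor (k + N + 2)).2.1 (m (k + N + 2) - 1 - (k + N + 1)) (by omega)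
    apply hne
    rw [show m (k + N + 2) - 1 - (k + N + 1) + t
        = m (k + N + 2) - 1 - (k + (N + 1 - t)) by omega,
      hbit _ (by omega), show k + N + 1 = k + (N + 1) by omega, hbit _ (by omega),
      hcon _ (by omega), hcon _ (by omega)]

/-- Appending `N + 1` digits to a word without long runs creates no long run if the first new digit
differs from the last old one. -/
lemma NoLongRun.extend {N m j i : ℕ} (hj : NoLongRun N m j) (hij : i / 2 ^ (N + 1) = j)
    (hne : i.testBit N ≠ i.testBit (N + 1)) : NoLongRun N (m + (N + 1)) i := by
  intro a ha
  by_cases haN : a ≤ N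
  · by_contra! hcon
    have h1 := hcon (N - a) (by omega)
    have h2 := hcon (N + 1 - a) (by omega)
    rw [Nat.add_sub_cancel' (by omega)] at h1 h2
    exact hne (h1.trans h2.symm)
  · obtain ⟨b, rfl⟩ : ∃ b, a = b + (N + 1) := ⟨a - (N + 1), by omega⟩
    obtain ⟨t, ht, h⟩ := hj b (by omega)
    refine ⟨t, ht, ?_⟩
    rwa [← hij, Nat.testBit_div_two_pow, Nat.testBit_div_two_pow,
      show b + t + (N + 1) = b + (N + 1) + t by omega] at h

lemma half_volume_le {N m : ℕ} {J : Set ℝ} (hJ : J ∈ admissibleIntervals N m) :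
    volume J / 2 ≤ volume (J ∩ ⋃ I ∈ admissibleIntervals N (m + (N + 1)), closure I) := by
  obtain ⟨j, hj, hr, rfl⟩ := hJ
  let h := 2 * j + (1 - j % 2)
  have hh : h / 2 ^ 1 = j := by omega
  have hvol : volume (dyadicIco m j) / 2 = volume (dyadicIco (m + 1) h) := by
    rw [volume_dyadicIco, volume_dyadicIco, pow_succ, div_eq_mul_inv]
  rw [hvol]
  refine measure_mono (subset_inter (dyadicIco_subset hh) ?_)
  intro x hx
  rw [mem_dyadicIco] at hx
  set i := ⌊2 ^ (m + (N + 1)) * x⌋₊ with hi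
  have h1 : i / 2 ^ N = h := by
    rw [hi, ← hx.2, ← floor_two_pow_mul_div (m + 1) N, show m + 1 + N = m + (N + 1) by omega]
  have h2 : i / 2 ^ (N + 1) = j := by
    rw [pow_succ, ← Nat.div_div_eq_div_mul, h1]
    omega
  have hne : i.testBit N ≠ i.testBit (N + 1) := by
    rw [Nat.testBit_eq_decide_div_mod_eq, Nat.testBit_eq_decide_div_mod_eq, h1, h2, ne_eq,
      decide_eq_decide]
    omega
  have hlt : i < 2 ^ (m + (N + 1)) := by
    rw [pow_add]
    exact (Nat.div_lt_iff_lt_mul (by positivity)).1 (h2 ▸ hj)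
  simp only [mem_iUnion, exists_prop]
  exact ⟨_, ⟨i, hlt, hr.extend h2 hne, rfl⟩, subset_closure (mem_dyadicIco.2 ⟨hx.1, hi.symm⟩)⟩

lemma subset_and_volume_lt {N m : ℕ} {I J : Set ℝ} (hJ : J ∈ admissibleIntervals N m)
    (hI : I ∈ admissibleIntervals N (m + (N + 1))) (hIJ : (I ∩ J).Nonempty) :
    I ⊆ J ∧ volume I < (2 : ℝ≥0∞)⁻¹ ^ N * volume J := by
  obtain ⟨j, -, -, rfl⟩ := hJ
  obtain ⟨i, -, -, rfl⟩ := hI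
  obtain ⟨x, hxI, hxJ⟩ := hIJ
  rw [mem_dyadicIco] at hxI hxJ
  refine ⟨dyadicIco_subset ?_, ?_⟩
  · rw [← hxI.2, floor_two_pow_mul_div, hxJ.2]
  · rw [volume_dyadicIco, volume_dyadicIco, ← pow_add]
    rw [← ENNReal.inv_pow, ← ENNReal.inv_pow, ENNReal.inv_lt_inv]
    exact_mod_cast Nat.pow_lt_pow_right one_lt_two (by omega)

/-- For every integer N ≥ 1 there is a sequence of finite collections of pairwise
disjoint dyadic subintervals of [0,1] whose closed unions K_k satisfy: F_N ⊆ K_k for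
all k; F_N = ⋂_k K_k; each J in the k-th collection meets K_{k+1} in measure ≥ |J|/2;
and intersecting intervals of consecutive generations are nested with length ratio
less than 2^{-N}. -/
theorem stmt_5 (N : ℕ) (hN : 1 ≤ N) :
    ∃ 𝒦 : ℕ → Set (Set ℝ),
      (∀ k, (𝒦 k).Finite) ∧
      (∀ k, ∀ J ∈ 𝒦 k, IsDyadicInterval J) ∧
      (∀ k, (𝒦 k).Pairwise Disjoint) ∧
      (∀ k, FN N ⊆ ⋃ J ∈ 𝒦 k, closure J) ∧
      (FN N = ⋂ k, ⋃ J ∈ 𝒦 k, closure J) ∧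
      (∀ k, ∀ J ∈ 𝒦 k,
        MeasureTheory.volume J / 2 ≤
          MeasureTheory.volume (J ∩ ⋃ I ∈ 𝒦 (k + 1), closure I)) ∧
      (∀ k, ∀ J ∈ 𝒦 k, ∀ I ∈ 𝒦 (k + 1), (I ∩ J).Nonempty →
        I ⊆ J ∧ MeasureTheory.volume I < (2 : ℝ≥0∞)⁻¹ ^ N * MeasureTheory.volume J) := by
  refine ⟨fun k ↦ admissibleIntervals N (k * (N + 1)), fun k ↦ finite_admissibleIntervals N _, ?_,
    fun k ↦ pairwise_disjoint_admissibleIntervals N _, fun k ↦ FN_subset_iUnion_closure N _,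
    (subset_iInter fun k ↦ FN_subset_iUnion_closure N _).antisymm
      (iInter_iUnion_closure_subset_FN N fun k ↦ Nat.le_mul_of_pos_right k N.succ_pos), ?_, ?_⟩
  · rintro k J ⟨j, hj, -, rfl⟩
    exact ⟨_, j, hj, rfl⟩
  · intro k J hJ
    simpa only [add_one_mul k (N + 1)] using half_volume_le hJ
  · intro k J hJ I hI
    simp only [add_one_mul k (N + 1)] at hI
    exact subset_and_volume_lt hJ hI
end

section
/- Let λ > 2 and regard the real segment [−ξ, ξ] as a subset of ℂ. If z ∈ ℂ ∖ [−ξ, ξ], then P(z) ∈ ℂ ∖ [−ξ, ξ]; that is, P maps the complement of [−ξ, ξ] into itself. -/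
/-- Let `λ > 2` and `ξ = (1 + √(1+4λ))/2` the positive fixed point of `P(z) = z² - λ`.
If `z ∈ ℂ \ [-ξ, ξ]` (the real segment regarded as a subset of `ℂ`),
then `P z ∈ ℂ \ [-ξ, ξ]`. -/
theorem stmt_10 (lam ξ : ℝ) (hlam : 2 < lam)
    (hξ : ξ = (1 + Real.sqrt (1 + 4 * lam)) / 2) (z : ℂ)
    (hz : z ∉ Complex.ofReal '' Set.Icc (-ξ) ξ) :
    z ^ 2 - (lam : ℂ) ∉ Complex.ofReal '' Set.Icc (-ξ) ξ := by
  rintro ⟨t, ⟨ht₁, ht₂⟩, ht⟩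
  apply hz
  have h_sqrt : Real.sqrt (1 + 4 * lam) ^ 2 = 1 + 4 * lam := Real.sq_sqrt (by linarith)
  have h_three : 3 ≤ Real.sqrt (1 + 4 * lam) := Real.le_sqrt_of_sq_le (by linarith)
  have h_two : 2 ≤ ξ := by linarith
  have h_fixed : ξ ^ 2 = ξ + lam := by
    rw [hξ]
    linear_combination h_sqrt / 4
  have h_nonneg : 0 ≤ lam + t := by nlinarith
  have h_le : Real.sqrt (lam + t) ≤ ξ := Real.sqrt_le_iff.mpr ⟨by linarith, by linarith⟩
  have h_pos := Real.sqrt_nonneg (lam + t)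
  have h_sq : z ^ 2 = (Real.sqrt (lam + t) : ℂ) ^ 2 := by
    rw [← Complex.ofReal_pow, Real.sq_sqrt h_nonneg]
    push_cast
    linear_combination -ht
  rcases sq_eq_sq_iff_eq_or_eq_neg.mp h_sq with h | h
  · exact ⟨Real.sqrt (lam + t), ⟨by linarith, h_le⟩, h.symm⟩
  · exact ⟨-Real.sqrt (lam + t), ⟨by linarith, by linarith⟩, by rw [h, Complex.ofReal_neg]⟩
end

section
/- Let λ > 2 and ρ = 2ξ. There exists an entire function F : ℂ → ℂ with F(0) = 0, F′(0) = 1, and satisfying the Poincaré equation P(F(z) + ξ) = F(ρz) + ξ for all z ∈ ℂ. -/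
/-- Taylor coefficients of the solution of `F (ρ z) = F z ^ 2 + ρ F z` with `F 0 = 0`, `F′ 0 = 1`. -/
noncomputable def poincareCoeff (ρ : ℝ) : ℕ → ℝ
  | 0 => 0
  | 1 => 1
  | n + 2 => (∑ i : Fin (n + 1), poincareCoeff ρ (i + 1) * poincareCoeff ρ (n + 1 - i)) /
      (ρ ^ (n + 2) - ρ)

theorem two_pow_sub_two_le {ρ : ℝ} (hρ : 2 ≤ ρ) (n : ℕ) :
    (2 : ℝ) ^ (n + 1) - 2 ≤ ρ ^ (n + 1) - ρ := by
  have h1 : (1 : ℝ) ≤ 2 ^ n := one_le_pow₀ (by norm_num)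
  have h2 : (2 : ℝ) ^ n ≤ ρ ^ n := by gcongr
  rw [pow_succ, pow_succ]
  nlinarith

theorem pow_sub_self_pos {ρ : ℝ} (hρ : 2 ≤ ρ) (n : ℕ) : 0 < ρ ^ (n + 2) - ρ := by
  have h : (1 : ℝ) ≤ 2 ^ n := one_le_pow₀ (by norm_num)
  have := two_pow_sub_two_le hρ (n + 1)
  rw [pow_succ, pow_succ] at this
  linarith

theorem poincareCoeff_add_two (ρ : ℝ) (n : ℕ) :
    poincareCoeff ρ (n + 2) =
      (∑ i ∈ Finset.range (n + 1), poincareCoeff ρ (i + 1) * poincareCoeff ρ (n + 1 - i)) /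
        (ρ ^ (n + 2) - ρ) := by
  rw [poincareCoeff, Finset.sum_range]

theorem sum_antidiagonal_add_two (g : ℕ → ℕ → ℝ) (n : ℕ) :
    ∑ p ∈ Finset.HasAntidiagonal.antidiagonal (n + 2), g p.1 p.2 =
      g 0 (n + 2) + ∑ i ∈ Finset.range (n + 1), g (i + 1) (n + 1 - i) + g (n + 2) 0 := by
  rw [Finset.Nat.sum_antidiagonal_eq_sum_range_succ g, Finset.sum_range_succ,
    Finset.sum_range_succ']
  simp only [Nat.sub_self, Nat.sub_zero]
  rw [add_comm (g 0 (n + 2))]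
  congr 2
  refine Finset.sum_congr rfl fun i _ => ?_
  congr 1
  omega

theorem sum_antidiagonal_poincareCoeff {ρ : ℝ} (hρ : 2 ≤ ρ) (n : ℕ) :
    ∑ p ∈ Finset.HasAntidiagonal.antidiagonal n, poincareCoeff ρ p.1 * poincareCoeff ρ p.2 =
      (ρ ^ n - ρ) * poincareCoeff ρ n := by
  match n with
  | 0 => simp [poincareCoeff]
  | 1 => simp [poincareCoeff, Finset.Nat.antidiagonal_succ]
  | n + 2 =>
    rw [sum_antidiagonal_add_two (fun i j => poincareCoeff ρ i * poincareCoeff ρ j),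
      poincareCoeff_add_two, mul_div_cancel₀ _ (pow_sub_self_pos hρ n).ne']
    simp [poincareCoeff]

theorem sum_inv_factorial_mul (n : ℕ) :
    ∑ p ∈ Finset.HasAntidiagonal.antidiagonal n, ((p.1.factorial : ℝ)⁻¹ * (p.2.factorial : ℝ)⁻¹) =
      2 ^ n / n.factorial := by
  have h := (Commute.all (1 : ℝ) 1).add_pow' n
  rw [show (2 : ℝ) = 1 + 1 by norm_num, h, Finset.sum_div]
  refine Finset.sum_congr rfl fun p hp => ?_
  rw [Finset.HasAntidiagonal.mem_antidiagonal] at hp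
  subst hp
  have hchoose : (((p.1 + p.2).choose p.1 * p.1.factorial * p.2.factorial : ℕ) : ℝ) =
      (p.1 + p.2).factorial := by
    rw [Nat.choose_symm_add, Nat.add_choose_mul_factorial_mul_factorial]
  push_cast at hchoose
  have h4 : (p.1.factorial : ℝ) ≠ 0 := by positivity
  have h5 : (p.2.factorial : ℝ) ≠ 0 := by positivity
  simp only [one_pow, mul_one, nsmul_eq_mul]
  field_simp
  linarith

theorem abs_poincareCoeff_le {ρ : ℝ} (hρ : 2 ≤ ρ) (n : ℕ) :
    |poincareCoeff ρ n| ≤ (n.factorial : ℝ)⁻¹ := by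
  induction n using Nat.strong_induction_on with
  | _ n ih =>
  match n with
  | 0 => simp [poincareCoeff]
  | 1 => simp [poincareCoeff]
  | n + 2 =>
    have hpos := pow_sub_self_pos hρ n
    have hsum := sum_inv_factorial_mul (n + 2)
    rw [sum_antidiagonal_add_two
      (fun i j => (i.factorial : ℝ)⁻¹ * (j.factorial : ℝ)⁻¹)] at hsum
    simp only [Nat.factorial_zero, Nat.cast_one, inv_one, one_mul, mul_one] at hsum
    rw [poincareCoeff_add_two, abs_div, abs_of_pos hpos, div_le_iff₀ hpos]
    calc _ ≤ ∑ i ∈ Finset.range (n + 1), |poincareCoeff ρ (i + 1) * poincareCoeff ρ (n + 1 - i)| :=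
          Finset.abs_sum_le_sum_abs _ _
      _ ≤ ∑ i ∈ Finset.range (n + 1),
            ((i + 1).factorial : ℝ)⁻¹ * ((n + 1 - i).factorial : ℝ)⁻¹ := by
          refine Finset.sum_le_sum fun i hi => ?_
          rw [Finset.mem_range] at hi
          rw [abs_mul]
          exact mul_le_mul (ih _ (by omega)) (ih _ (by omega)) (abs_nonneg _) (by positivity)
      _ = ((n + 2).factorial : ℝ)⁻¹ * (2 ^ (n + 2) - 2) := by
          rw [div_eq_mul_inv] at hsum
          linear_combination hsum
      _ ≤ _ := by
          gcongr ?_ * ?_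
          exact two_pow_sub_two_le hρ (n + 1)

theorem summable_norm_poincareCoeff_mul_pow {ρ : ℝ} (hρ : 2 ≤ ρ) (z : ℂ) :
    Summable fun n => ‖(poincareCoeff ρ n : ℂ) * z ^ n‖ := by
  refine Summable.of_nonneg_of_le (fun _ => norm_nonneg _) (fun n => ?_)
    (Real.summable_pow_div_factorial ‖z‖)
  rw [norm_mul, norm_pow, Complex.norm_real, Real.norm_eq_abs, div_eq_inv_mul]
  gcongr
  exact abs_poincareCoeff_le hρ n

/-- The Poincaré function of `w ↦ w ^ 2 + ρ w` at its fixed point `0`. -/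
noncomputable def poincareFun (ρ : ℝ) (z : ℂ) : ℂ := ∑' n, (poincareCoeff ρ n : ℂ) * z ^ n

theorem hasFPowerSeriesOnBall_poincareFun {ρ : ℝ} (hρ : 2 ≤ ρ) :
    HasFPowerSeriesOnBall (poincareFun ρ)
      (FormalMultilinearSeries.ofScalars ℂ fun n => (poincareCoeff ρ n : ℂ)) 0 ⊤ where
  r_le := by
    rw [top_le_iff]
    refine FormalMultilinearSeries.radius_eq_top_of_summable_norm _ fun r => ?_
    refine (summable_norm_poincareCoeff_mul_pow hρ (r : ℝ)).of_nonneg_of_le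
      (fun _ => by positivity) fun n => ?_
    simp
  r_pos := by simp
  hasSum := by
    intro z _
    have h := (summable_norm_poincareCoeff_mul_pow hρ z).of_norm.hasSum
    simpa [FormalMultilinearSeries.ofScalars_apply_eq, poincareFun, mul_comm] using h

theorem poincareFun_mul {ρ : ℝ} (hρ : 2 ≤ ρ) (z : ℂ) :
    poincareFun ρ (ρ * z) = poincareFun ρ z ^ 2 + ρ * poincareFun ρ z := by
  have hs := summable_norm_poincareCoeff_mul_pow hρ z
  have hs' := (summable_norm_poincareCoeff_mul_pow hρ (ρ * z)).of_norm
  have hsq : poincareFun ρ z ^ 2 =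
      ∑' n, ((poincareCoeff ρ n : ℂ) * (ρ * z) ^ n - ρ * (poincareCoeff ρ n * z ^ n)) := by
    rw [sq, poincareFun, tsum_mul_tsum_eq_tsum_sum_antidiagonal_of_summable_norm hs hs]
    refine tsum_congr fun n => ?_
    have h := congrArg (fun x : ℝ => (x : ℂ) * z ^ n) (sum_antidiagonal_poincareCoeff hρ n)
    push_cast at h
    rw [Finset.sum_mul] at h
    rw [mul_pow]
    trans ((ρ : ℂ) ^ n - ρ) * poincareCoeff ρ n * z ^ n
    · rw [← h]
      refine Finset.sum_congr rfl fun p hp => ?_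
      rw [← Finset.HasAntidiagonal.mem_antidiagonal.mp hp, pow_add]
      ring
    · ring
  rw [hsq, hs'.tsum_sub (hs.of_norm.mul_left _), tsum_mul_left]
  simp [poincareFun]

/-- Let `λ > 2`, `ξ = (1 + √(1+4λ))/2` the positive fixed point of `P(z) = z² - λ`,
and `ρ = 2ξ`. There exists an entire function `F` with `F 0 = 0`, `F′ 0 = 1`, and
`P (F z + ξ) = F (ρ z) + ξ` for all `z`. -/
theorem stmt_12 (lam ξ ρ : ℝ) (hlam : 2 < lam)
    (hξ : ξ = (1 + Real.sqrt (1 + 4 * lam)) / 2) (hρ : ρ = 2 * ξ) :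
    ∃ F : ℂ → ℂ, Differentiable ℂ F ∧ F 0 = 0 ∧ deriv F 0 = 1 ∧
      ∀ z : ℂ, (F z + (ξ : ℂ)) ^ 2 - (lam : ℂ) = F ((ρ : ℂ) * z) + (ξ : ℂ) := by
  have hsqrt : Real.sqrt (1 + 4 * lam) ^ 2 = 1 + 4 * lam := Real.sq_sqrt (by linarith)
  have hρ2 : 2 ≤ ρ := by
    have : 1 ≤ Real.sqrt (1 + 4 * lam) := Real.one_le_sqrt.mpr (by linarith)
    linarith
  have hfix : (ξ : ℂ) ^ 2 - lam = ξ := by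
    have : ξ ^ 2 - lam = ξ := by rw [hξ]; linear_combination hsqrt / 4
    exact_mod_cast this
  have hF := hasFPowerSeriesOnBall_poincareFun hρ2
  refine ⟨poincareFun ρ, fun z => (hF.analyticAt_of_mem (by simp)).differentiableAt, ?_, ?_,
    fun z => ?_⟩
  · rw [← hF.hasFPowerSeriesAt.coeff_zero (fun _ => 0)]
    simp [FormalMultilinearSeries.ofScalars, poincareCoeff]
  · rw [hF.hasFPowerSeriesAt.deriv]
    simp [poincareCoeff]
  · rw [poincareFun_mul hρ2, hρ]
    push_cast
    linear_combination hfix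
end

section
/- Let λ > 2, ρ = 2ξ, and let P̂(w) = w(w + ρ), so that P̂ is the conjugate of P by the translation w ↦ w + ξ. Then the sequence of polynomials z ↦ P̂^{∘n}(z/ρⁿ) converges locally uniformly on ℂ to an entire function F satisfying F(0) = 0, F′(0) = 1, and P̂(F(z)) = F(ρz) for all z ∈ ℂ. -/
open Filter Topology

/-- `exp x - 1` is a global majorant of the linearizer of `t ↦ t (t + ρ)` for `ρ ≥ 2`. -/
lemma quad_exp_sub_one_le {ρ : ℝ} (hρ : 2 ≤ ρ) {x : ℝ} (hx : 0 ≤ x) :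
    (Real.exp x - 1) * (Real.exp x - 1 + ρ) ≤ Real.exp (ρ * x) - 1 := by
  have hv : 0 ≤ Real.exp x - 1 := by linarith [Real.add_one_le_exp x]
  have hB := one_add_mul_self_le_rpow_one_add (s := Real.exp x - 1) (by linarith)
    (p := ρ / 2) (by linarith)
  have hrw : (1 + (Real.exp x - 1)) ^ (ρ / 2) = Real.exp (ρ * x / 2) := by
    rw [add_sub_cancel, ← Real.exp_mul]
    congr 1
    ring
  have hsq : Real.exp (ρ * x) = Real.exp (ρ * x / 2) ^ 2 := by
    rw [← Real.exp_nat_mul]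
    congr 1
    push_cast
    ring
  rw [hrw] at hB
  have h := pow_le_pow_left₀ (by positivity) hB 2
  rw [hsq]
  nlinarith [mul_nonneg (sub_nonneg.2 hρ) (sq_nonneg (Real.exp x - 1)),
    mul_nonneg (mul_nonneg (sub_nonneg.2 hρ) (sub_nonneg.2 hρ)) (sq_nonneg (Real.exp x - 1))]

lemma iterate_quad_nonneg {ρ : ℝ} (hρ : 0 ≤ ρ) (n : ℕ) {y : ℝ} (hy : 0 ≤ y) :
    0 ≤ (fun t : ℝ => t * (t + ρ))^[n] y := by
  induction n generalizing y with
  | zero => simpa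
  | succ n ih =>
    rw [Function.iterate_succ_apply]
    exact ih (by positivity)

lemma iterate_quad_le_exp {ρ : ℝ} (hρ : 2 ≤ ρ) (n : ℕ) {x y : ℝ} (hx : 0 ≤ x) (hy : 0 ≤ y)
    (hyx : y ≤ Real.exp x - 1) :
    (fun t : ℝ => t * (t + ρ))^[n] y ≤ Real.exp (ρ ^ n * x) - 1 := by
  induction n generalizing x y with
  | zero => simpa using hyx
  | succ n ih =>
    rw [Function.iterate_succ_apply, pow_succ, mul_assoc]
    refine ih (by positivity) (by positivity) (le_trans ?_ (quad_exp_sub_one_le hρ hx))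
    gcongr
    linarith

lemma norm_iterate_quad_sub_le {ρ : ℝ} (hρ : 0 ≤ ρ) (n : ℕ) {y : ℝ} (hy : 0 < y) {a b : ℂ}
    (ha : ‖a‖ ≤ y / 2) (hb : ‖b‖ ≤ y / 2) :
    ‖(fun w : ℂ => w * (w + ρ))^[n] a - (fun w : ℂ => w * (w + ρ))^[n] b‖ * y ≤
      ‖a - b‖ * (fun t : ℝ => t * (t + ρ))^[n] y := by
  induction n generalizing y a b with
  | zero => simp
  | succ n ih =>
    have hnorm (c : ℂ) (hc : ‖c‖ ≤ y / 2) : ‖c * (c + ρ)‖ ≤ y * (y + ρ) / 2 := by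
      rw [norm_mul]
      calc ‖c‖ * ‖c + ρ‖ ≤ (y / 2) * (y + ρ) := by
            gcongr
            refine (norm_add_le _ _).trans ?_
            rw [Complex.norm_of_nonneg hρ]
            linarith
        _ = _ := by ring
    have hd : ‖a * (a + ρ) - b * (b + ρ)‖ ≤ ‖a - b‖ * (y + ρ) := by
      rw [show a * (a + ρ) - b * (b + ρ) = (a - b) * (a + b + ρ) by ring, norm_mul]
      gcongr
      refine (norm_add₃_le).trans ?_
      rw [Complex.norm_of_nonneg hρ]
      linarith
    have h := ih (y := y * (y + ρ)) (by positivity) (hnorm a ha) (hnorm b hb)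
    simp only [Function.iterate_succ_apply]
    refine le_of_mul_le_mul_right ?_ (show 0 < y + ρ by positivity)
    have := mul_le_mul_of_nonneg_right hd
      (iterate_quad_nonneg hρ n (show 0 ≤ y * (y + ρ) by positivity))
    linarith

lemma dist_rescaled_iterate_succ_le {ρ : ℝ} (hρ : 2 ≤ ρ) {R : ℝ} (hR : 0 < R) (n : ℕ) {z : ℂ}
    (hz : ‖z‖ ≤ R) :
    dist ((fun w : ℂ => w * (w + ρ))^[n] (z / (ρ : ℂ) ^ n))
        ((fun w : ℂ => w * (w + ρ))^[n + 1] (z / (ρ : ℂ) ^ (n + 1))) ≤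
      R * Real.exp (2 * R * (1 + R)) * ρ⁻¹ ^ n := by
  have hρ0 : 0 < ρ := by linarith
  have hρC : (ρ : ℂ) ≠ 0 := by exact_mod_cast hρ0.ne'
  have hpow : 1 ≤ ρ ^ n := one_le_pow₀ (by linarith)
  set S := 2 * R * (1 + R) with hS
  have hS0 : 0 < S := by positivity
  have hdiff : z / (ρ : ℂ) ^ (n + 1) * (z / (ρ : ℂ) ^ (n + 1) + ρ) =
      z / (ρ : ℂ) ^ n + (z / (ρ : ℂ) ^ (n + 1)) ^ 2 := by
    field_simp
    ring
  have hnorm (k : ℕ) : ‖z / (ρ : ℂ) ^ k‖ ≤ R / ρ ^ k := by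
    rw [norm_div, norm_pow, Complex.norm_of_nonneg hρ0.le]
    gcongr
  have hsq : ‖(z / (ρ : ℂ) ^ (n + 1)) ^ 2‖ ≤ R ^ 2 / ρ ^ n * (ρ⁻¹ ^ n) := by
    rw [norm_pow]
    calc ‖z / (ρ : ℂ) ^ (n + 1)‖ ^ 2 ≤ (R / ρ ^ n) ^ 2 := by
          gcongr
          refine (hnorm _).trans ?_
          gcongr
          · linarith
          · omega
      _ = _ := by rw [inv_pow]; field_simp
  have hsq' : R ^ 2 / ρ ^ n * (ρ⁻¹ ^ n) ≤ R ^ 2 / ρ ^ n := by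
    refine mul_le_of_le_one_right (by positivity) ?_
    rw [inv_pow]
    exact inv_le_one_of_one_le₀ hpow
  have hSn : S / ρ ^ n / 2 = R / ρ ^ n + R ^ 2 / ρ ^ n := by
    rw [hS]
    ring
  have h := norm_iterate_quad_sub_le hρ0.le n (y := S / ρ ^ n) (by positivity)
    (a := z / (ρ : ℂ) ^ n) (b := z / (ρ : ℂ) ^ (n + 1) * (z / (ρ : ℂ) ^ (n + 1) + ρ))
    (by rw [hSn]; exact (hnorm n).trans (le_add_of_nonneg_right (by positivity)))
    (by
      rw [hSn, hdiff]
      exact (norm_add_le _ _).trans (add_le_add (hnorm n) (hsq.trans hsq')))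
  have hexp := iterate_quad_le_exp hρ n (x := S / ρ ^ n) (y := S / ρ ^ n) (by positivity)
    (by positivity) (by linarith [Real.add_one_le_exp (S / ρ ^ n)])
  rw [mul_div_cancel₀ _ (by positivity : ρ ^ n ≠ 0)] at hexp
  have hab : ‖z / (ρ : ℂ) ^ n - z / (ρ : ℂ) ^ (n + 1) * (z / (ρ : ℂ) ^ (n + 1) + ρ)‖ ≤
      R ^ 2 / ρ ^ n * (ρ⁻¹ ^ n) := by
    rw [hdiff, sub_add_cancel_left, norm_neg]
    exact hsq
  rw [dist_eq_norm, Function.iterate_succ_apply]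
  refine le_of_mul_le_mul_right (h.trans ?_) (show 0 < S / ρ ^ n by positivity)
  calc _ ≤ R ^ 2 / ρ ^ n * ρ⁻¹ ^ n * Real.exp S := by
        refine mul_le_mul hab (by linarith) (iterate_quad_nonneg hρ0.le n (by positivity))
          (by positivity)
    _ ≤ R * S / ρ ^ n * ρ⁻¹ ^ n * Real.exp S := by
        gcongr
        nlinarith [mul_pos hR hR]
    _ = _ := by ring

/-- For `ρ ≥ 2` the rescaled iterates of `w ↦ w (w + ρ)` converge locally uniformly on `ℂ`. -/
lemma exists_tendstoLocallyUniformly_rescaled_iterate {ρ : ℝ} (hρ : 2 ≤ ρ) :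
    ∃ F : ℂ → ℂ, TendstoLocallyUniformly
      (fun (n : ℕ) (z : ℂ) => (fun w : ℂ => w * (w + ρ))^[n] (z / (ρ : ℂ) ^ n)) F atTop := by
  have hr : ρ⁻¹ < 1 := inv_lt_one_of_one_lt₀ (by linarith)
  have hr0 : 0 ≤ ρ⁻¹ := inv_nonneg.2 (by linarith)
  have hlim (z : ℂ) := cauchySeq_tendsto_of_complete
    (cauchySeq_of_le_geometric _ _ hr fun n =>
      dist_rescaled_iterate_succ_le hρ (R := ‖z‖ + 1) (by positivity) n (by linarith))
  choose F hF using hlim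
  refine ⟨F, Metric.tendstoLocallyUniformly_iff.2 fun ε hε x => ?_⟩
  refine ⟨Metric.ball x 1, Metric.ball_mem_nhds x one_pos, ?_⟩
  set R := ‖x‖ + 1
  have hR : 0 < R := by positivity
  have hT : Tendsto (fun n : ℕ => R * Real.exp (2 * R * (1 + R)) * ρ⁻¹ ^ n / (1 - ρ⁻¹)) atTop
      (𝓝 0) := by
    simpa using ((tendsto_pow_atTop_nhds_zero_of_lt_one hr0 hr).const_mul
      (R * Real.exp (2 * R * (1 + R)))).div_const (1 - ρ⁻¹)
  filter_upwards [hT.eventually_lt_const hε] with n hn y hy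
  have hy' : ‖y‖ ≤ R := by
    have := norm_le_norm_add_norm_sub' y x
    rw [Metric.mem_ball, dist_eq_norm] at hy
    linarith
  rw [dist_comm]
  exact (dist_le_of_le_geometric_of_tendsto _ _ hr
    (fun n => dist_rescaled_iterate_succ_le hρ hR n hy') (hF y) n).trans_lt hn

/-- Let `λ > 2`, `ξ = (1 + √(1+4λ))/2` the positive fixed point of `P(z) = z² - λ`,
`ρ = 2ξ` and `P̂ w = w (w + ρ)` the conjugate of `P` by `w ↦ w + ξ`. Then the
polynomials `z ↦ P̂^[n] (z / ρⁿ)` converge locally uniformly on `ℂ` to an entire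
function `F` with `F 0 = 0`, `F′ 0 = 1`, and `P̂ (F z) = F (ρ z)` for all `z`. -/
theorem stmt_13 (lam ξ ρ : ℝ) (hlam : 2 < lam)
    (hξ : ξ = (1 + Real.sqrt (1 + 4 * lam)) / 2) (hρ : ρ = 2 * ξ)
    (Phat : ℂ → ℂ) (hPhat : ∀ w : ℂ, Phat w = w * (w + (ρ : ℂ))) :
    ∃ F : ℂ → ℂ, Differentiable ℂ F ∧ F 0 = 0 ∧ deriv F 0 = 1 ∧
      (∀ z : ℂ, Phat (F z) = F ((ρ : ℂ) * z)) ∧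
      TendstoLocallyUniformly
        (fun (n : ℕ) (z : ℂ) => Phat^[n] (z / (ρ : ℂ) ^ n)) F Filter.atTop := by
  have hρ2 : 2 ≤ ρ := by
    have : 1 ≤ Real.sqrt (1 + 4 * lam) := Real.one_le_sqrt.2 (by linarith)
    linarith
  have hρC : (ρ : ℂ) ≠ 0 := by exact_mod_cast (by linarith : ρ ≠ 0)
  obtain rfl : Phat = fun w => w * (w + (ρ : ℂ)) := funext hPhat
  obtain ⟨F, hF⟩ := exists_tendstoLocallyUniformly_rescaled_iterate hρ2
  have hFon := tendstoLocallyUniformlyOn_univ.2 hF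
  have hpt (z : ℂ) := hFon.tendsto_at (Set.mem_univ z)
  have hdiff (n : ℕ) : Differentiable ℂ
      (fun z : ℂ => (fun w : ℂ => w * (w + (ρ : ℂ)))^[n] (z / (ρ : ℂ) ^ n)) :=
    (Differentiable.iterate (by fun_prop) n).comp (by fun_prop)
  have hderiv (n : ℕ) : deriv
      (fun z : ℂ => (fun w : ℂ => w * (w + (ρ : ℂ)))^[n] (z / (ρ : ℂ) ^ n)) 0 = 1 := by
    have hP : HasDerivAt (fun w : ℂ => w * (w + (ρ : ℂ))) (ρ : ℂ) 0 := by
      simpa using (hasDerivAt_id' (0 : ℂ)).fun_mul ((hasDerivAt_id' (0 : ℂ)).add_const (ρ : ℂ))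
    have hPn := HasDerivAt.iterate 0 hP (by simp) n
    have hdiv := (hasDerivAt_id (0 : ℂ)).div_const ((ρ : ℂ) ^ n)
    have hcomp := HasDerivAt.comp (0 : ℂ) (h := fun z => id z / (ρ : ℂ) ^ n)
      (by simpa using hPn) hdiv
    refine hcomp.deriv.trans ?_
    field_simp
  refine ⟨F, ?_, ?_, ?_, fun z => ?_, hF⟩
  · exact differentiableOn_univ.1 (hFon.differentiableOn
      (.of_forall fun n => (hdiff n).differentiableOn) isOpen_univ)
  · refine tendsto_nhds_unique (hpt 0) (tendsto_const_nhds.congr fun n => ?_)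
    rw [zero_div, Function.iterate_fixed (by simp)]
  · have h := (hFon.deriv (.of_forall fun n => (hdiff n).differentiableOn)
      isOpen_univ).tendsto_at (Set.mem_univ 0)
    refine tendsto_nhds_unique h (tendsto_const_nhds.congr fun n => ?_)
    exact (hderiv n).symm
  · have h := (hpt (ρ * z)).comp (tendsto_add_atTop_nat 1)
    refine tendsto_nhds_unique ((hpt z).mul ((hpt z).add_const (ρ : ℂ))) (h.congr fun n => ?_)
    rw [Function.comp_apply, Function.iterate_succ_apply', pow_succ', mul_div_mul_left _ _ hρC]
end
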